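/- arXiv:2212.00781 — 4 statements merged into one kernel-verified Lean document; each statement's English description precedes it below -/
import Mathlib

section
/- Let m ≥ 1, M := 6·m·L, and suppose f is bounded below: f(y) ≥ f⋆ for all y ∈ E. Let x_0, x_1, … be iterates such that for every k ≥ 0, x_{k+1} is a lazy cubic Newton step T_M(x_k, x_{π(k)}), where π(k) := k − (k mod m). Let ε > 0, t ≥ 1 and k := t·m, and assume ‖∇f(x_i)‖ ≥ ε for all 1 ≤ i ≤ k. Then f(x_0) − f⋆ ≥ k·ε^{3/2}/(144·√(3·m·L)); equivalently, k ≤ 144·√(3·m·L)·(f(x_0) − f⋆)/ε^{3/2}. -/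
open scoped InnerProductSpace

/-- A curve starting at the origin whose speed on `[0, 1)` is at most `C (n + 1) t ^ n` has norm at
most `C` at time `1`. -/
lemma norm_apply_one_le_of_norm_deriv_le_pow {F : Type*} [NormedAddCommGroup F] [NormedSpace ℝ F]
    {φ φ' : ℝ → F} {C : ℝ} (n : ℕ) (hφ : ∀ t, HasDerivAt φ (φ' t) t) (h0 : φ 0 = 0)
    (hbound : ∀ t, 0 ≤ t → ‖φ' t‖ ≤ C * ((n + 1) * t ^ n)) : ‖φ 1‖ ≤ C := by
  have hB : ∀ t : ℝ, HasDerivAt (fun t : ℝ => C * t ^ (n + 1)) (C * ((n + 1) * t ^ n)) t := by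
    intro t
    simpa using (hasDerivAt_pow (n + 1) t).const_mul C
  have := image_norm_le_of_norm_deriv_right_le_deriv_boundary (a := 0) (b := 1)
    (f := φ) (f' := φ') (B := fun t : ℝ => C * t ^ (n + 1))
    (fun t _ => (hφ t).continuousAt.continuousWithinAt)
    (fun t _ => (hφ t).hasDerivWithinAt) (by simp [h0]) hB (fun t ht => hbound t ht.1)
    (Set.right_mem_Icc.2 zero_le_one)
  simpa using this

section LipschitzHessian

variable {E : Type*} [NormedAddCommGroup E] [InnerProductSpace ℝ E]
  {f : E → ℝ} {g : E → E} {H : E → E →L[ℝ] E} {L : ℝ}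

/-- First-order Taylor bound for a map with Lipschitz derivative. -/
lemma norm_taylor_gradient_le (hH : ∀ y, HasFDerivAt g (H y) y)
    (hLip : ∀ y₁ y₂, ‖H y₁ - H y₂‖ ≤ L * ‖y₁ - y₂‖) (x d : E) :
    ‖g (x + d) - g x - H x d‖ ≤ L / 2 * ‖d‖ ^ 2 := by
  have key := norm_apply_one_le_of_norm_deriv_le_pow
    (φ := fun t : ℝ => g (x + t • d) - g x - t • H x d)
    (φ' := fun t : ℝ => H (x + t • d) d - H x d) (C := L / 2 * ‖d‖ ^ 2) 1 ?_ (by simp) ?_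
  · simpa using key
  · intro t
    have hline : HasDerivAt (fun t : ℝ => x + t • d) d t := by
      simpa using ((hasDerivAt_id t).smul_const d).const_add x
    have hlin : HasDerivAt (fun t : ℝ => t • H x d) (H x d) t := by
      simpa using (hasDerivAt_id t).smul_const (H x d)
    exact (((hH (x + t • d)).comp_hasDerivAt t hline).sub_const (g x)).sub hlin
  · intro t ht
    calc ‖H (x + t • d) d - H x d‖ = ‖(H (x + t • d) - H x) d‖ := by simp
      _ ≤ ‖H (x + t • d) - H x‖ * ‖d‖ := ContinuousLinearMap.le_opNorm _ _
      _ ≤ L * ‖x + t • d - x‖ * ‖d‖ := by gcongr; exact hLip _ _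
      _ = L / 2 * ‖d‖ ^ 2 * (((1 : ℕ) + 1) * t ^ 1) := by
        rw [add_sub_cancel_left, norm_smul, Real.norm_of_nonneg ht]; push_cast; ring

/-- Bound on the gradient after a lazy cubic Newton step `d` from `x` with the Hessian evaluated
at `z`. -/
lemma lazy_cubic_step_norm_gradient_le (hH : ∀ y, HasFDerivAt g (H y) y)
    (hLip : ∀ y₁ y₂, ‖H y₁ - H y₂‖ ≤ L * ‖y₁ - y₂‖) {x z d : E} {M : ℝ} (hM : 0 ≤ M)
    (hstep : g x + H z d + (M * ‖d‖ / 2) • d = 0) :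
    ‖g (x + d)‖ ≤ L / 2 * ‖d‖ ^ 2 + L * ‖x - z‖ * ‖d‖ + M / 2 * ‖d‖ ^ 2 := by
  have hsplit : g (x + d) = (g (x + d) - g x - H x d) + (H x - H z) d - (M * ‖d‖ / 2) • d := by
    rw [eq_neg_of_add_eq_zero_right hstep, sub_apply]; abel
  have h₁ := norm_taylor_gradient_le hH hLip x d
  have h₂ : ‖(H x - H z) d‖ ≤ L * ‖x - z‖ * ‖d‖ :=
    ((H x - H z).le_opNorm d).trans (by gcongr; exact hLip _ _)
  have h₃ : ‖(M * ‖d‖ / 2) • d‖ = M / 2 * ‖d‖ ^ 2 := by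
    rw [norm_smul, Real.norm_of_nonneg (by positivity)]; ring
  rw [hsplit]
  refine (norm_sub_le _ _).trans ?_
  have := norm_add_le (g (x + d) - g x - H x d) ((H x - H z) d)
  linarith

variable [CompleteSpace E]

/-- Second-order Taylor bound for a function with Lipschitz Hessian. -/
lemma abs_taylor_hessian_le (hg : ∀ y, HasGradientAt f (g y) y)
    (hH : ∀ y, HasFDerivAt g (H y) y)
    (hLip : ∀ y₁ y₂, ‖H y₁ - H y₂‖ ≤ L * ‖y₁ - y₂‖) (x d : E) :
    |f (x + d) - f x - ⟪g x, d⟫_ℝ - ⟪H x d, d⟫_ℝ / 2| ≤ L / 6 * ‖d‖ ^ 3 := by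
  have key := norm_apply_one_le_of_norm_deriv_le_pow
    (φ := fun t : ℝ => f (x + t • d) - f x - t * ⟪g x, d⟫_ℝ - t ^ 2 * (⟪H x d, d⟫_ℝ / 2))
    (φ' := fun t : ℝ => ⟪g (x + t • d), d⟫_ℝ - ⟪g x, d⟫_ℝ - (2 * t) * (⟪H x d, d⟫_ℝ / 2))
    (C := L / 6 * ‖d‖ ^ 3) 2 ?_ (by simp) ?_
  · simpa using key
  · intro t
    have hline : HasDerivAt (fun t : ℝ => x + t • d) d t := by
      simpa using ((hasDerivAt_id t).smul_const d).const_add x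
    have hfline : HasDerivAt (fun t : ℝ => f (x + t • d)) ⟪g (x + t • d), d⟫_ℝ t := by
      have h := (hg (x + t • d)).hasFDerivAt.comp_hasDerivAt t hline
      rw [InnerProductSpace.toDual_apply_apply] at h
      exact h
    have hlin : HasDerivAt (fun t : ℝ => t * ⟪g x, d⟫_ℝ) ⟪g x, d⟫_ℝ t := by
      simpa using (hasDerivAt_id t).mul_const ⟪g x, d⟫_ℝ
    have hquad : HasDerivAt (fun t : ℝ => t ^ 2 * (⟪H x d, d⟫_ℝ / 2))
        ((2 * t) * (⟪H x d, d⟫_ℝ / 2)) t := by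
      simpa using (hasDerivAt_pow 2 t).mul_const (⟪H x d, d⟫_ℝ / 2)
    exact ((hfline.sub_const (f x)).sub hlin).sub hquad
  · intro t ht
    calc ‖⟪g (x + t • d), d⟫_ℝ - ⟪g x, d⟫_ℝ - (2 * t) * (⟪H x d, d⟫_ℝ / 2)‖
        = ‖⟪g (x + t • d) - g x - H x (t • d), d⟫_ℝ‖ := by
          rw [inner_sub_left, inner_sub_left, map_smul, real_inner_smul_left]; ring_nf
      _ ≤ ‖g (x + t • d) - g x - H x (t • d)‖ * ‖d‖ := norm_inner_le_norm _ _
      _ ≤ L / 2 * ‖t • d‖ ^ 2 * ‖d‖ := by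
          gcongr; exact norm_taylor_gradient_le hH hLip x (t • d)
      _ = L / 6 * ‖d‖ ^ 3 * (((2 : ℕ) + 1) * t ^ 2) := by
          rw [norm_smul, Real.norm_of_nonneg ht]; push_cast; ring

/-- Decrease of the objective along a lazy cubic Newton step `d` from `x` with the Hessian
evaluated at `z`. -/
lemma lazy_cubic_step_decrease (hg : ∀ y, HasGradientAt f (g y) y)
    (hH : ∀ y, HasFDerivAt g (H y) y)
    (hLip : ∀ y₁ y₂, ‖H y₁ - H y₂‖ ≤ L * ‖y₁ - y₂‖) {x z d : E} {M : ℝ}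
    (hstep : g x + H z d + (M * ‖d‖ / 2) • d = 0)
    (hpsd : 0 ≤ ⟪H z d, d⟫_ℝ + M * ‖d‖ / 2 * ‖d‖ ^ 2) :
    M / 4 * ‖d‖ ^ 3 - L / 2 * ‖x - z‖ * ‖d‖ ^ 2 - L / 6 * ‖d‖ ^ 3 ≤ f x - f (x + d) := by
  have htaylor := (abs_le.1 (abs_taylor_hessian_le hg hH hLip x d)).2
  have hstat : ⟪g x, d⟫_ℝ + ⟪H z d, d⟫_ℝ + M * ‖d‖ / 2 * ‖d‖ ^ 2 = 0 := by
    have := congrArg (fun v => ⟪v, d⟫_ℝ) hstep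
    simpa [inner_add_left, real_inner_smul_left, real_inner_self_eq_norm_sq] using this
  have hdiff : ⟪H x d, d⟫_ℝ - ⟪H z d, d⟫_ℝ ≤ L * ‖x - z‖ * ‖d‖ ^ 2 := by
    calc ⟪H x d, d⟫_ℝ - ⟪H z d, d⟫_ℝ = ⟪(H x - H z) d, d⟫_ℝ := by simp [inner_sub_left]
      _ ≤ ‖(H x - H z) d‖ * ‖d‖ := real_inner_le_norm _ _
      _ ≤ L * ‖x - z‖ * ‖d‖ * ‖d‖ := by
          gcongr
          exact ((H x - H z).le_opNorm d).trans (by gcongr; exact hLip _ _)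
      _ = L * ‖x - z‖ * ‖d‖ ^ 2 := by ring
  have h₁ : M * ‖d‖ / 2 * ‖d‖ ^ 2 = M / 2 * ‖d‖ ^ 3 := by ring
  rw [h₁] at hstat hpsd
  linarith

end LipschitzHessian

/-- For nonnegative reals, the product of the sum and the sum of squares is at most the number of
terms times the sum of cubes. -/
lemma sum_mul_sum_sq_le_card_mul_sum_cube {ι : Type*} (s : Finset ι) {r : ι → ℝ}
    (hr : ∀ i ∈ s, 0 ≤ r i) :
    (∑ i ∈ s, r i) * ∑ i ∈ s, r i ^ 2 ≤ s.card * ∑ i ∈ s, r i ^ 3 := by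
  refine MonovaryOn.sum_mul_sum_le_card_mul_sum (f := r) (g := fun i => r i ^ 2) ?_ |>.trans_eq ?_
  · intro i hi j hj hij
    exact (lt_of_pow_lt_pow_left₀ 2 (hr j hj) hij).le
  · congr 1
    exact Finset.sum_congr rfl fun i _ => by ring

/-- Decrease of the objective over a phase of `m` lazy cubic Newton steps that share the Hessian
at `y 0`, as long as the gradients stay large. -/
lemma lazy_cubic_phase_decrease {E : Type*} [NormedAddCommGroup E] [InnerProductSpace ℝ E]
    [CompleteSpace E] {f : E → ℝ} {g : E → E} {H : E → E →L[ℝ] E} {L : ℝ} (hL : 0 < L)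
    (hg : ∀ y, HasGradientAt f (g y) y) (hH : ∀ y, HasFDerivAt g (H y) y)
    (hLip : ∀ y₁ y₂, ‖H y₁ - H y₂‖ ≤ L * ‖y₁ - y₂‖)
    {m : ℕ} (hm : 1 ≤ m) {M : ℝ} (hM : M = 6 * (m : ℝ) * L) {y : ℕ → E}
    (hstep : ∀ j < m, g (y j) + H (y 0) (y (j + 1) - y j)
        + (M * ‖y (j + 1) - y j‖ / 2) • (y (j + 1) - y j) = 0)
    (hpsd : ∀ j < m, ∀ h : E,
      0 ≤ ⟪H (y 0) h, h⟫_ℝ + M * ‖y (j + 1) - y j‖ / 2 * ‖h‖ ^ 2)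
    {a : ℝ} (ha : 0 ≤ a) (hgrad : ∀ j < m, a ^ 2 ≤ ‖g (y (j + 1))‖) :
    m * a ^ 3 / (54 * √(m * L)) ≤ f (y 0) - f (y m) := by
  have hm1 : (1 : ℝ) ≤ m := by exact_mod_cast hm
  have hm0 : (0 : ℝ) < m := by linarith
  set b := √(m * L)
  have hb0 : 0 < b := Real.sqrt_pos.2 (by positivity)
  have hb2 : b ^ 2 = m * L := Real.sq_sqrt (by positivity)
  set r : ℕ → ℝ := fun j => ‖y (j + 1) - y j‖
  have hr : ∀ j, 0 ≤ r j := fun j => norm_nonneg _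
  set R := ∑ j ∈ Finset.range m, r j
  set A := ∑ j ∈ Finset.range m, r j ^ 3 with hA
  have hR0 : 0 ≤ R := Finset.sum_nonneg fun j _ => hr j
  have hA0 : 0 ≤ A := Finset.sum_nonneg fun j _ => pow_nonneg (hr j) 3
  have hdist : ∀ j < m, ‖y j - y 0‖ ≤ R := by
    intro j hj
    rw [← Finset.sum_range_sub]
    refine (norm_sum_le _ _).trans ?_
    exact Finset.sum_le_sum_of_subset_of_nonneg (Finset.range_mono hj.le) fun i _ _ => hr i
  have hnext : ∀ j, y j + (y (j + 1) - y j) = y (j + 1) := fun j => by abel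
  have hdec : ∀ j < m, (3 / 2 * m * L - L / 6) * r j ^ 3 - L / 2 * R * r j ^ 2 ≤
      f (y j) - f (y (j + 1)) := by
    intro j hj
    have h := lazy_cubic_step_decrease hg hH hLip (hstep j hj) (hpsd j hj _)
    rw [hnext] at h
    have h' : L / 2 * ‖y j - y 0‖ * r j ^ 2 ≤ L / 2 * R * r j ^ 2 := by
      gcongr; exact hdist j hj
    change M / 4 * r j ^ 3 - L / 2 * ‖y j - y 0‖ * r j ^ 2 - L / 6 * r j ^ 3 ≤ _ at h
    rw [hM] at h
    linarith
  have hD : b ^ 2 / 2 * A ≤ f (y 0) - f (y m) := by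
    have hsum : (3 / 2 * m * L - L / 6) * A - L / 2 * R * ∑ j ∈ Finset.range m, r j ^ 2 ≤
        f (y 0) - f (y m) := by
      rw [← Finset.sum_range_sub' (fun j => f (y j)), hA, Finset.mul_sum, Finset.mul_sum, ← Finset.sum_sub_distrib]
      exact Finset.sum_le_sum fun j hj => hdec j (Finset.mem_range.1 hj)
    have hcheb := sum_mul_sum_sq_le_card_mul_sum_cube (Finset.range m) fun j _ => hr j
    rw [Finset.card_range] at hcheb
    have h₁ := mul_le_mul_of_nonneg_left hcheb (by positivity : 0 ≤ L / 2)
    have h₂ : L * A ≤ m * (L * A) := le_mul_of_one_le_left (by positivity) hm1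
    have h₃ : 0 ≤ L * A := by positivity
    rw [hb2]
    linarith
  have hspeed : ∀ j < m, a ≤ b * (2 * r j + R / m) := by
    intro j hj
    have h := (hgrad j hj).trans ((congrArg (fun v => ‖g v‖) (hnext j)).ge.trans
      (lazy_cubic_step_norm_gradient_le hH hLip (by rw [hM]; positivity) (hstep j hj)))
    change a ^ 2 ≤ L / 2 * r j ^ 2 + L * ‖y j - y 0‖ * r j + M / 2 * r j ^ 2 at h
    have h' : L * ‖y j - y 0‖ * r j ≤ L * R * r j := by
      have := hr j
      gcongr
      exact hdist j hj
    refine le_of_sq_le_sq ?_ (by have := hr j; positivity)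
    have hexp : (b * (2 * r j + R / m)) ^ 2 =
        4 * (m * (L * r j ^ 2)) + 4 * (L * R * r j) + L * R ^ 2 / m := by
      rw [mul_pow, hb2]; field_simp; ring
    have h₁ : L * r j ^ 2 ≤ m * (L * r j ^ 2) := le_mul_of_one_le_left (by positivity) hm1
    have h₂ : 0 ≤ L * R * r j := by have := hr j; positivity
    have h₃ : 0 ≤ L * R ^ 2 / m := by positivity
    have h₄ : 0 ≤ L * r j ^ 2 := by positivity
    rw [hexp]
    rw [hM] at h
    linarith
  have hsum : m * a ≤ 3 * b * R := by
    have := Finset.sum_le_sum fun j hj => hspeed j (Finset.mem_range.1 hj)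
    rw [← Finset.mul_sum, Finset.sum_add_distrib, ← Finset.mul_sum] at this
    simp only [Finset.sum_const, Finset.card_range, nsmul_eq_mul] at this
    rw [mul_div_cancel₀ _ hm0.ne'] at this
    linarith
  have hpow : R ^ 3 ≤ m ^ 2 * A := by
    have h := pow_sum_div_card_le_sum_pow (s := Finset.range m) (f := r) (fun j _ => hr j) 2
    rw [Finset.card_range, div_le_iff₀ (by positivity)] at h
    exact h.trans_eq (mul_comm _ _)
  have hcube : m * a ^ 3 ≤ 27 * b ^ 3 * A := by
    have h₁ : (m * a) ^ 3 ≤ (3 * b * R) ^ 3 := pow_le_pow_left₀ (by positivity) hsum 3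
    have h₂ := mul_le_mul_of_nonneg_left hpow (by positivity : 0 ≤ 27 * b ^ 3)
    refine le_of_mul_le_mul_left ?_ (by positivity : (0 : ℝ) < m ^ 2)
    linarith
  refine le_trans ?_ hD
  rw [div_le_iff₀ (by positivity)]
  linarith

theorem lazy_cubic_global_complexity
    {E : Type*} [NormedAddCommGroup E] [InnerProductSpace ℝ E] [FiniteDimensional ℝ E]
    (f : E → ℝ) (g : E → E) (H : E → E →L[ℝ] E) (L : ℝ)
    (hL : 0 < L) (hf : ContDiff ℝ 2 f)
    (hg : ∀ y, HasGradientAt f (g y) y)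
    (hH : ∀ y, HasFDerivAt g (H y) y)
    (hsym : ∀ y u v, ⟪H y u, v⟫_ℝ = ⟪u, H y v⟫_ℝ)
    (hLip : ∀ y₁ y₂, ‖H y₁ - H y₂‖ ≤ L * ‖y₁ - y₂‖)
    (m : ℕ) (hm : 1 ≤ m) (M : ℝ) (hM : M = 6 * (m : ℝ) * L) (x : ℕ → E)
    (hstep : ∀ k : ℕ,
      g (x k) + H (x (k - k % m)) (x (k + 1) - x k)
        + (M * ‖x (k + 1) - x k‖ / 2) • (x (k + 1) - x k) = 0)
    (hpsd : ∀ k : ℕ, ∀ h : E,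
      0 ≤ ⟪H (x (k - k % m)) h, h⟫_ℝ + M * ‖x (k + 1) - x k‖ / 2 * ‖h‖ ^ 2)
    (fstar : ℝ) (hbelow : ∀ y, fstar ≤ f y)
    (t : ℕ) (ht : 1 ≤ t)
    (ε : ℝ) (hε : 0 < ε)
    (hgrad : ∀ i, 1 ≤ i → i ≤ t * m → ε ≤ ‖g (x i)‖) :
    f (x 0) - fstar ≥ ((t * m : ℕ) : ℝ) * ε ^ ((3 : ℝ) / 2) / (144 * Real.sqrt (3 * (m : ℝ) * L)) := by
  have hm0 : (0 : ℝ) < m := by exact_mod_cast hm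
  have hphase : ∀ p < t, m * √ε ^ 3 / (54 * √(m * L)) ≤ f (x (p * m)) - f (x ((p + 1) * m)) := by
    intro p hp
    have hanchor : ∀ j < m, p * m + j - (p * m + j) % m = p * m + 0 := by
      intro j hj
      rw [Nat.mul_add_mod_of_lt hj]; omega
    have h := lazy_cubic_phase_decrease hL hg hH hLip hm hM (y := fun j => x (p * m + j))
      (fun j hj => by simpa only [hanchor j hj, ← add_assoc] using hstep (p * m + j))
      (fun j hj => by simpa only [hanchor j hj, ← add_assoc] using hpsd (p * m + j))
      (Real.sqrt_nonneg ε) (fun j hj => by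
        rw [Real.sq_sqrt hε.le]
        refine hgrad _ (by omega) ?_
        calc p * m + (j + 1) ≤ (p + 1) * m := by rw [add_mul, one_mul]; omega
          _ ≤ t * m := Nat.mul_le_mul_right m hp)
    simpa only [add_zero, add_mul, one_mul] using h
  have htel : t * (m * √ε ^ 3 / (54 * √(m * L))) ≤ f (x 0) - f (x (t * m)) := by
    have h := Finset.sum_le_sum fun p hp => hphase p (Finset.mem_range.1 hp)
    rw [Finset.sum_range_sub' (fun p => f (x (p * m)))] at h
    simpa using h
  have hpow : ε ^ ((3 : ℝ) / 2) = √ε ^ 3 := by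
    rw [Real.sqrt_eq_rpow, ← Real.rpow_natCast, ← Real.rpow_mul hε.le]
    norm_num
  have hsqrt : 54 * √(m * L) ≤ 144 * √(3 * m * L) := by
    have h : √(m * L) ≤ √(3 * m * L) := Real.sqrt_le_sqrt (by nlinarith [mul_pos hm0 hL])
    linarith [Real.sqrt_nonneg (3 * m * L)]
  have hb0 : 0 < √(m * L) := Real.sqrt_pos.2 (by positivity)
  calc ((t * m : ℕ) : ℝ) * ε ^ ((3 : ℝ) / 2) / (144 * √(3 * m * L))
      ≤ ((t * m : ℕ) : ℝ) * √ε ^ 3 / (54 * √(m * L)) := by rw [hpow]; gcongr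
    _ = t * (m * √ε ^ 3 / (54 * √(m * L))) := by push_cast; ring
    _ ≤ f (x 0) - f (x (t * m)) := htel
    _ ≤ f (x 0) - fstar := by linarith [hbelow (x (t * m))]
end

section
/- Let x, z ∈ E, λ > 0, and let x⁺ be the regularized lazy Newton step from x with Hessian snapshot z and regularization λ. Then ‖∇f(x⁺)‖ ≤ ( (L/2)·‖x⁺ − x‖ + λ + L·‖z − x‖ ) · ‖x⁺ − x‖. -/
open scoped InnerProductSpace

/-- First-order Taylor estimate for a map whose derivative is Lipschitz continuous. -/
theorem norm_sub_sub_le_of_lipschitz_fderiv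
    {E F : Type*} [NormedAddCommGroup E] [NormedSpace ℝ E] [NormedAddCommGroup F]
    [NormedSpace ℝ F] {g : E → F} {H : E → E →L[ℝ] F} {L : ℝ}
    (hH : ∀ y, HasFDerivAt g (H y) y)
    (hLip : ∀ y₁ y₂, ‖H y₁ - H y₂‖ ≤ L * ‖y₁ - y₂‖) (x d : E) :
    ‖g (x + d) - g x - H x d‖ ≤ L / 2 * ‖d‖ ^ 2 := by
  have hderiv : ∀ t : ℝ, HasDerivAt (fun t : ℝ => g (x + t • d) - g x - t • H x d)
      (H (x + t • d) d - H x d) t := by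
    intro t
    have hline : HasDerivAt (fun t : ℝ => x + t • d) d t := by
      simpa using ((hasDerivAt_id t).smul_const d).const_add x
    have hlin : HasDerivAt (fun t : ℝ => t • H x d) (H x d) t := by
      simpa using (hasDerivAt_id t).smul_const (H x d)
    exact (((hH (x + t • d)).comp_hasDerivAt t hline).sub_const (g x)).sub hlin
  have hB : ∀ t : ℝ, HasDerivAt (fun t : ℝ => L / 2 * ‖d‖ ^ 2 * t ^ 2)
      (L * ‖d‖ ^ 2 * t) t := by
    intro t
    refine ((hasDerivAt_pow 2 t).const_mul (L / 2 * ‖d‖ ^ 2)).congr_deriv ?_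
    norm_num
    ring
  have h := image_norm_le_of_norm_deriv_right_le_deriv_boundary (a := 0) (b := 1)
    (fun t _ => (hderiv t).continuousAt.continuousWithinAt)
    (fun t _ => (hderiv t).hasDerivWithinAt) (by simp) hB
    (fun t ht => by
      calc ‖H (x + t • d) d - H x d‖ = ‖(H (x + t • d) - H x) d‖ := by simp
        _ ≤ ‖H (x + t • d) - H x‖ * ‖d‖ := ContinuousLinearMap.le_opNorm _ _
        _ ≤ L * ‖x + t • d - x‖ * ‖d‖ := by gcongr; exact hLip _ _
        _ = L * ‖d‖ ^ 2 * t := by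
          rw [add_sub_cancel_left, norm_smul, Real.norm_of_nonneg ht.1]
          ring)
    (Set.right_mem_Icc.2 zero_le_one)
  simpa using h

theorem grad_reg_newton_grad_bound
    {E : Type*} [NormedAddCommGroup E] [InnerProductSpace ℝ E] [FiniteDimensional ℝ E]
    (f : E → ℝ) (g : E → E) (H : E → E →L[ℝ] E) (L : ℝ)
    (hL : 0 < L) (hf : ContDiff ℝ 2 f)
    (hg : ∀ y, HasGradientAt f (g y) y)
    (hH : ∀ y, HasFDerivAt g (H y) y)
    (hsym : ∀ y u v, ⟪H y u, v⟫_ℝ = ⟪u, H y v⟫_ℝ)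
    (hLip : ∀ y₁ y₂, ‖H y₁ - H y₂‖ ≤ L * ‖y₁ - y₂‖)
    (x z xp : E) (lam : ℝ)
    (hstep : g x + H z (xp - x) + lam • (xp - x) = 0)
    (hlam : 0 < lam) :
    ‖g xp‖ ≤ (L / 2 * ‖xp - x‖ + lam + L * ‖z - x‖) * ‖xp - x‖ := by
  have hT := norm_sub_sub_le_of_lipschitz_fderiv hH hLip x (xp - x)
  rw [add_sub_cancel] at hT
  have hS : ‖(H x - H z) (xp - x)‖ ≤ L * ‖z - x‖ * ‖xp - x‖ := by
    refine (ContinuousLinearMap.le_opNorm _ _).trans ?_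
    rw [norm_sub_rev z x]
    gcongr
    exact hLip x z
  have hR : ‖lam • (xp - x)‖ = lam * ‖xp - x‖ := by
    rw [norm_smul, Real.norm_of_nonneg hlam.le]
  have hdecomp : g xp = (g xp - g x - H x (xp - x)) + (H x - H z) (xp - x)
      - lam • (xp - x) := by
    rw [sub_apply, ← sub_eq_zero, ← hstep]
    abel
  calc ‖g xp‖ ≤ ‖g xp - g x - H x (xp - x)‖ + ‖(H x - H z) (xp - x)‖
        + ‖lam • (xp - x)‖ := by
        conv_lhs => rw [hdecomp]
        exact (norm_sub_le _ _).trans (by gcongr; exact norm_add_le _ _)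
    _ ≤ L / 2 * ‖xp - x‖ ^ 2 + L * ‖z - x‖ * ‖xp - x‖ + lam * ‖xp - x‖ := by
        rw [hR]
        gcongr
    _ = (L / 2 * ‖xp - x‖ + lam + L * ‖z - x‖) * ‖xp - x‖ := by ring
end

section
/- Assume f is convex and let M ≥ 3·L. Let x, z ∈ E with ∇f(x) ≠ 0, set λ := √(M·‖∇f(x)‖), and let x⁺ be the regularized lazy Newton step from x with Hessian snapshot z and regularization λ. Then f(x) − f(x⁺) ≥ (λ/4)·‖x⁺ − x‖² − (8·L³/(27·M²))·‖z − x‖³. -/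
open scoped InnerProductSpace

theorem nonneg_of_hasDerivAt_nonneg {p p' : ℝ → ℝ} (hp : ∀ t, HasDerivAt p (p' t) t)
    (h0 : p 0 = 0) (hp' : ∀ t, 0 ≤ t → 0 ≤ p' t) {t : ℝ} (ht : 0 ≤ t) : 0 ≤ p t := by
  have hmono : MonotoneOn p (Set.Ici 0) :=
    monotoneOn_of_deriv_nonneg (convex_Ici 0)
      (fun s _ => (hp s).continuousAt.continuousWithinAt)
      (fun s _ => (hp s).differentiableAt.differentiableWithinAt)
      (fun s hs => by
        rw [interior_Ici] at hs
        rw [(hp s).deriv]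
        exact hp' s (le_of_lt hs))
  simpa [h0] using hmono (Set.mem_Ici.2 le_rfl) (Set.mem_Ici.2 ht) ht

theorem inner_apply_sub_le_of_lipschitz
    {E : Type*} [NormedAddCommGroup E] [InnerProductSpace ℝ E] {H : E → E →L[ℝ] E} {L : ℝ}
    (hLip : ∀ y₁ y₂, ‖H y₁ - H y₂‖ ≤ L * ‖y₁ - y₂‖) (y₁ y₂ h : E) :
    ⟪H y₁ h, h⟫_ℝ - ⟪H y₂ h, h⟫_ℝ ≤ L * ‖y₁ - y₂‖ * ‖h‖ ^ 2 := by
  calc ⟪H y₁ h, h⟫_ℝ - ⟪H y₂ h, h⟫_ℝ = ⟪(H y₁ - H y₂) h, h⟫_ℝ := by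
        rw [sub_apply, inner_sub_left]
    _ ≤ ‖(H y₁ - H y₂) h‖ * ‖h‖ := real_inner_le_norm _ _
    _ ≤ L * ‖y₁ - y₂‖ * ‖h‖ * ‖h‖ := by
        gcongr
        exact (H y₁ - H y₂).le_of_opNorm_le (hLip y₁ y₂) h
    _ = L * ‖y₁ - y₂‖ * ‖h‖ ^ 2 := by ring

/-- The cubic upper model of a function with Lipschitz continuous Hessian. -/
theorem le_cubic_model_of_lipschitz_hessian
    {E : Type*} [NormedAddCommGroup E] [InnerProductSpace ℝ E] [CompleteSpace E]
    {f : E → ℝ} {g : E → E} {H : E → E →L[ℝ] E} {L : ℝ}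
    (hg : ∀ y, HasGradientAt f (g y) y) (hH : ∀ y, HasFDerivAt g (H y) y)
    (hLip : ∀ y₁ y₂, ‖H y₁ - H y₂‖ ≤ L * ‖y₁ - y₂‖) (x h : E) :
    f (x + h) ≤ f x + ⟪g x, h⟫_ℝ + 1 / 2 * ⟪H x h, h⟫_ℝ + L / 6 * ‖h‖ ^ 3 := by
  have hline (t : ℝ) : HasDerivAt (fun s : ℝ => x + s • h) h t := by
    simpa using ((hasDerivAt_id t).smul_const h).const_add x
  have hf1 (t : ℝ) : HasDerivAt (fun s : ℝ => f (x + s • h)) ⟪g (x + t • h), h⟫_ℝ t := by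
    simpa [Function.comp_def] using (hg (x + t • h)).hasFDerivAt.comp_hasDerivAt t (hline t)
  have hf2 (t : ℝ) : HasDerivAt (fun s : ℝ => ⟪g (x + s • h), h⟫_ℝ)
      ⟪H (x + t • h) h, h⟫_ℝ t := by
    simpa using ((hH (x + t • h)).comp_hasDerivAt t (hline t)).inner ℝ (hasDerivAt_const t h)
  have hp1 (t : ℝ) : HasDerivAt
      (fun s : ℝ => ⟪g x, h⟫_ℝ + s * ⟪H x h, h⟫_ℝ + s ^ 2 * (L / 2 * ‖h‖ ^ 3)
        - ⟪g (x + s • h), h⟫_ℝ)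
      (⟪H x h, h⟫_ℝ + t * (L * ‖h‖ ^ 3) - ⟪H (x + t • h) h, h⟫_ℝ) t := by
    refine HasDerivAt.congr_deriv (((((hasDerivAt_id t).mul_const ⟪H x h, h⟫_ℝ).const_add ⟪g x, h⟫_ℝ).add
      ((hasDerivAt_pow 2 t).mul_const (L / 2 * ‖h‖ ^ 3))).sub (hf2 t)) ?_
    push_cast
    ring
  have hp0 (t : ℝ) : HasDerivAt
      (fun s : ℝ => f x + s * ⟪g x, h⟫_ℝ + s ^ 2 * (1 / 2 * ⟪H x h, h⟫_ℝ)
        + s ^ 3 * (L / 6 * ‖h‖ ^ 3) - f (x + s • h))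
      (⟪g x, h⟫_ℝ + t * ⟪H x h, h⟫_ℝ + t ^ 2 * (L / 2 * ‖h‖ ^ 3) - ⟪g (x + t • h), h⟫_ℝ) t := by
    refine HasDerivAt.congr_deriv ((((((hasDerivAt_id t).mul_const ⟪g x, h⟫_ℝ).const_add (f x)).add
      ((hasDerivAt_pow 2 t).mul_const (1 / 2 * ⟪H x h, h⟫_ℝ))).add
      ((hasDerivAt_pow 3 t).mul_const (L / 6 * ‖h‖ ^ 3))).sub (hf1 t)) ?_
    push_cast
    ring
  have hsecond (t : ℝ) (ht : 0 ≤ t) :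
      0 ≤ ⟪H x h, h⟫_ℝ + t * (L * ‖h‖ ^ 3) - ⟪H (x + t • h) h, h⟫_ℝ := by
    have hb := inner_apply_sub_le_of_lipschitz hLip (x + t • h) x h
    rw [add_sub_cancel_left, norm_smul, Real.norm_of_nonneg ht] at hb
    linarith
  have hmodel := nonneg_of_hasDerivAt_nonneg hp0 (by simp)
    (fun t ht => nonneg_of_hasDerivAt_nonneg hp1 (by simp) hsecond ht) zero_le_one
  simp only [one_smul, one_pow, one_mul] at hmodel
  linarith

theorem grad_reg_newton_func_progress
    {E : Type*} [NormedAddCommGroup E] [InnerProductSpace ℝ E] [FiniteDimensional ℝ E]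
    (f : E → ℝ) (g : E → E) (H : E → E →L[ℝ] E) (L : ℝ)
    (hL : 0 < L) (hf : ContDiff ℝ 2 f)
    (hg : ∀ y, HasGradientAt f (g y) y)
    (hH : ∀ y, HasFDerivAt g (H y) y)
    (hsym : ∀ y u v, ⟪H y u, v⟫_ℝ = ⟪u, H y v⟫_ℝ)
    (hLip : ∀ y₁ y₂, ‖H y₁ - H y₂‖ ≤ L * ‖y₁ - y₂‖)
    (hconv : ∀ y h, 0 ≤ ⟪H y h, h⟫_ℝ)
    (x z xp : E) (lam : ℝ)
    (hstep : g x + H z (xp - x) + lam • (xp - x) = 0)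
    (M : ℝ) (hM : 3 * L ≤ M) (hgx : g x ≠ 0)
    (hlam : lam = Real.sqrt (M * ‖g x‖)) :
    f x - f xp ≥ lam / 4 * ‖xp - x‖ ^ 2 - 8 * L ^ 3 / (27 * M ^ 2) * ‖z - x‖ ^ 3 := by
  set h := xp - x with hh
  have hr := norm_nonneg h
  have hd := norm_nonneg (z - x)
  have hMpos : 0 < M := by linarith
  have hgpos : 0 < ‖g x‖ := norm_pos_iff.2 hgx
  have hlampos : 0 < lam := hlam ▸ Real.sqrt_pos.2 (mul_pos hMpos hgpos)
  have hlamsq : lam ^ 2 = M * ‖g x‖ := hlam ▸ Real.sq_sqrt (by positivity)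
  have hinner : ⟪g x, h⟫_ℝ + ⟪H z h, h⟫_ℝ + lam * ‖h‖ ^ 2 = 0 := by
    have := congrArg (fun v => ⟪v, h⟫_ℝ) hstep
    simpa [inner_add_left, real_inner_smul_left, real_inner_self_eq_norm_sq] using this
  have hstep_le : M * ‖h‖ ≤ lam := by
    rcases hr.eq_or_lt with h0 | hrpos
    · rw [← h0, mul_zero]
      exact hlampos.le
    · have hcs : -⟪g x, h⟫_ℝ ≤ ‖g x‖ * ‖h‖ :=
        (neg_le_abs _).trans (abs_real_inner_le_norm _ _)
      have hle : lam * ‖h‖ ≤ ‖g x‖ := by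
        refine le_of_mul_le_mul_right ?_ hrpos
        linarith [hconv z h]
      refine le_of_mul_le_mul_left ?_ hlampos
      linarith [mul_le_mul_of_nonneg_left hle hMpos.le]
  have hmodel := le_cubic_model_of_lipschitz_hessian hg hH hLip x h
  rw [hh, add_sub_cancel, ← hh] at hmodel
  have hsnap := inner_apply_sub_le_of_lipschitz hLip x z h
  rw [norm_sub_rev x z] at hsnap
  have hyoung : L / 2 * ‖z - x‖ * ‖h‖ ^ 2 ≤
      8 * L ^ 3 / (27 * M ^ 2) * ‖z - x‖ ^ 3 + 1 / 4 * (M * ‖h‖) * ‖h‖ ^ 2 := by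
    have key : 0 ≤ (4 * (L * ‖z - x‖) - 3 * (M * ‖h‖)) ^ 2 *
        (2 * (L * ‖z - x‖) + 3 * (M * ‖h‖)) / (108 * M ^ 2) := by positivity
    have heq : 8 * L ^ 3 / (27 * M ^ 2) * ‖z - x‖ ^ 3 + 1 / 4 * (M * ‖h‖) * ‖h‖ ^ 2
        - L / 2 * ‖z - x‖ * ‖h‖ ^ 2 = (4 * (L * ‖z - x‖) - 3 * (M * ‖h‖)) ^ 2 *
        (2 * (L * ‖z - x‖) + 3 * (M * ‖h‖)) / (108 * M ^ 2) := by
      field_simp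
      ring
    linarith
  have hcubic : L * ‖h‖ ^ 3 ≤ lam / 3 * ‖h‖ ^ 2 := by
    have : 3 * L * ‖h‖ ≤ lam := (mul_le_mul_of_nonneg_right hM hr).trans hstep_le
    nlinarith [mul_le_mul_of_nonneg_right this (sq_nonneg ‖h‖)]
  have hquad := mul_le_mul_of_nonneg_right hstep_le (sq_nonneg ‖h‖)
  have hnonneg : 0 ≤ lam * ‖h‖ ^ 2 := by positivity
  linarith [hconv z h]
end

section
/- Assume f is strongly convex with parameter μ > 0 and attains its minimum at x⋆ (so ∇f(x⋆) = 0). Let x, z ∈ E, M ≥ 0, and let T satisfy the lazy cubic Newton step stationarity conditions T_M(x, z) with r := ‖T − x‖. Then ‖∇f(T)‖ ≤ ((M + 3L)/(2·μ²))·‖∇f(x)‖² + (L/μ²)·‖∇f(x)‖·‖∇f(z)‖. -/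
open scoped InnerProductSpace

section

variable {E : Type*} [NormedAddCommGroup E]

/-- The derivative of a map restricted to a line. -/
theorem HasFDerivAt.hasDerivAt_comp_add_smul [NormedSpace ℝ E] {g : E → E} {g' : E →L[ℝ] E}
    {x d : E} {t : ℝ} (hg : HasFDerivAt g g' (x + t • d)) :
    HasDerivAt (fun s : ℝ => g (x + s • d)) (g' d) t := by
  have hline : HasDerivAt (fun s : ℝ => x + s • d) d t := by
    simpa using ((hasDerivAt_id t).smul_const d).const_add x
  exact hg.comp_hasDerivAt t hline

/-- First-order Taylor bound for a map with Lipschitz derivative. -/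
theorem norm_sub_sub_fderiv_le_of_lipschitz [NormedSpace ℝ E] {g : E → E} {H : E → E →L[ℝ] E}
    {L : ℝ} (hH : ∀ y, HasFDerivAt g (H y) y)
    (hLip : ∀ y₁ y₂, ‖H y₁ - H y₂‖ ≤ L * ‖y₁ - y₂‖) (x d : E) :
    ‖g (x + d) - g x - H x d‖ ≤ L / 2 * ‖d‖ ^ 2 := by
  have hderiv (t : ℝ) : HasDerivAt (fun s : ℝ => g (x + s • d) - g x - s • H x d)
      (H (x + t • d) d - H x d) t := by
    have hlin : HasDerivAt (fun s : ℝ => s • H x d) (H x d) t := by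
      simpa using (hasDerivAt_id t).smul_const (H x d)
    exact ((hH _).hasDerivAt_comp_add_smul.sub_const (g x)).sub hlin
  have hbound (t : ℝ) : HasDerivAt (fun s : ℝ => L * ‖d‖ ^ 2 / 2 * s ^ 2)
      (L * ‖d‖ ^ 2 * t) t := by
    refine ((hasDerivAt_pow 2 t).const_mul (L * ‖d‖ ^ 2 / 2)).congr_deriv ?_
    norm_num
    ring
  have h := image_norm_le_of_norm_deriv_right_le_deriv_boundary (a := 0) (b := 1)
    (fun t _ => (hderiv t).continuousAt.continuousWithinAt)
    (fun t _ => (hderiv t).hasDerivWithinAt) (by simp) hbound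
    (fun t ht => by
      calc ‖H (x + t • d) d - H x d‖ = ‖(H (x + t • d) - H x) d‖ := by simp
        _ ≤ ‖H (x + t • d) - H x‖ * ‖d‖ := ContinuousLinearMap.le_opNorm _ _
        _ ≤ L * ‖x + t • d - x‖ * ‖d‖ := by gcongr; exact hLip _ _
        _ = L * ‖d‖ ^ 2 * t := by
          rw [add_sub_cancel_left, norm_smul, Real.norm_of_nonneg ht.1]
          ring)
    (Set.right_mem_Icc.2 zero_le_one)
  simp only [one_smul, one_pow, mul_one] at h
  linarith

/-- A map whose derivative is coercive with constant `μ` expands distances by at least `μ`. -/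
theorem mul_norm_sub_le_of_coercive_fderiv [InnerProductSpace ℝ E] {g : E → E}
    {H : E → E →L[ℝ] E} {μ : ℝ} (hH : ∀ y, HasFDerivAt g (H y) y)
    (hsc : ∀ y h, μ * ‖h‖ ^ 2 ≤ ⟪H y h, h⟫_ℝ) (a b : E) :
    μ * ‖a - b‖ ≤ ‖g a - g b‖ := by
  have hderiv (t : ℝ) : HasDerivAt (fun s : ℝ => ⟪g (b + s • (a - b)), a - b⟫_ℝ)
      ⟪H (b + t • (a - b)) (a - b), a - b⟫_ℝ t := by
    refine ((hH _).hasDerivAt_comp_add_smul.inner ℝ (hasDerivAt_const t (a - b))).congr_deriv ?_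
    rw [inner_zero_right, zero_add]
  obtain ⟨c, -, hc⟩ := exists_hasDerivAt_eq_slope _ _ zero_lt_one
    (fun t _ => (hderiv t).continuousAt.continuousWithinAt) (fun t _ => hderiv t)
  simp only [one_smul, zero_smul, add_zero, add_sub_cancel, sub_zero, div_one,
    ← inner_sub_left] at hc
  have h := (hsc (b + c • (a - b)) (a - b)).trans (hc.trans_le (real_inner_le_norm _ _))
  rcases (norm_nonneg (a - b)).eq_or_lt with h0 | h0
  · simp [← h0]
  · exact le_of_mul_le_mul_right (by linarith) h0

/-- A regularized Newton step with a `μ`-coercive operator has length at most `‖v‖ / μ`. -/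
theorem mul_norm_le_of_add_add_smul_eq_zero [InnerProductSpace ℝ E] {A : E →L[ℝ] E}
    {v d : E} {c μ : ℝ} (hc : 0 ≤ c) (hA : μ * ‖d‖ ^ 2 ≤ ⟪A d, d⟫_ℝ)
    (h : v + A d + c • d = 0) : μ * ‖d‖ ≤ ‖v‖ := by
  have hinner : ⟪v, d⟫_ℝ + ⟪A d, d⟫_ℝ + c * ‖d‖ ^ 2 = 0 := by
    rw [← real_inner_self_eq_norm_sq, ← real_inner_smul_left, ← inner_add_left,
      ← inner_add_left, h, inner_zero_left]
  have hv := neg_le_of_abs_le (abs_real_inner_le_norm v d)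
  have hcd : 0 ≤ c * ‖d‖ ^ 2 := by positivity
  rcases (norm_nonneg d).eq_or_lt with h0 | h0
  · simp [← h0]
  · exact le_of_mul_le_mul_right (by linarith) h0

end

theorem lazy_cubic_local_grad_bound
    {E : Type*} [NormedAddCommGroup E] [InnerProductSpace ℝ E] [FiniteDimensional ℝ E]
    (f : E → ℝ) (g : E → E) (H : E → E →L[ℝ] E) (L : ℝ)
    (hL : 0 < L) (hf : ContDiff ℝ 2 f)
    (hg : ∀ y, HasGradientAt f (g y) y)
    (hH : ∀ y, HasFDerivAt g (H y) y)
    (hsym : ∀ y u v, ⟪H y u, v⟫_ℝ = ⟪u, H y v⟫_ℝ)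
    (hLip : ∀ y₁ y₂, ‖H y₁ - H y₂‖ ≤ L * ‖y₁ - y₂‖)
    (μ : ℝ) (hμ : 0 < μ)
    (hsc : ∀ y h, μ * ‖h‖ ^ 2 ≤ ⟪H y h, h⟫_ℝ)
    (xstar : E) (hmin : ∀ y, f xstar ≤ f y) (hgstar : g xstar = 0)
    (x z T : E) (M r : ℝ) (hr : r = ‖T - x‖)
    (hstat : g x + H z (T - x) + (M * r / 2) • (T - x) = 0)
    (hpsd : ∀ h : E, 0 ≤ ⟪H z h, h⟫_ℝ + M * r / 2 * ‖h‖ ^ 2)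
    (hM : 0 ≤ M) :
    ‖g T‖ ≤ (M + 3 * L) / (2 * μ ^ 2) * ‖g x‖ ^ 2 + L / μ ^ 2 * ‖g x‖ * ‖g z‖ := by
  have hr0 : 0 ≤ r := hr ▸ norm_nonneg _
  have hstep : r ≤ ‖g x‖ / μ := by
    rw [le_div_iff₀' hμ, hr]
    exact mul_norm_le_of_add_add_smul_eq_zero (by positivity) (hsc z _) hstat
  have hdist : ‖x - z‖ ≤ (‖g x‖ + ‖g z‖) / μ := by
    rw [le_div_iff₀' hμ]
    exact (mul_norm_sub_le_of_coercive_fderiv hH hsc x z).trans (norm_sub_le _ _)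
  have htaylor : ‖g T - g x - H x (T - x)‖ ≤ L / 2 * r ^ 2 := by
    simpa [hr] using norm_sub_sub_fderiv_le_of_lipschitz hH hLip x (T - x)
  have hlazy : ‖(H x - H z) (T - x)‖ ≤ L * ‖x - z‖ * r := by
    rw [hr]
    exact (ContinuousLinearMap.le_opNorm _ _).trans (by gcongr; exact hLip x z)
  have hreg : ‖(M * r / 2) • (T - x)‖ = M / 2 * r ^ 2 := by
    rw [norm_smul, Real.norm_of_nonneg (by positivity), ← hr]
    ring
  have hdecomp : g T = (g T - g x - H x (T - x)) + (H x - H z) (T - x)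
      - (M * r / 2) • (T - x) := by
    rw [← sub_eq_zero, ← hstat, sub_apply]
    abel
  calc ‖g T‖ ≤ ‖g T - g x - H x (T - x)‖ + ‖(H x - H z) (T - x)‖
        + ‖(M * r / 2) • (T - x)‖ := by
        conv_lhs => rw [hdecomp]
        exact (norm_sub_le _ _).trans (by gcongr; exact norm_add_le _ _)
    _ ≤ L / 2 * r ^ 2 + L * ‖x - z‖ * r + M / 2 * r ^ 2 := by rw [hreg]; gcongr
    _ ≤ L / 2 * (‖g x‖ / μ) ^ 2 + L * ((‖g x‖ + ‖g z‖) / μ) * (‖g x‖ / μ)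
        + M / 2 * (‖g x‖ / μ) ^ 2 := by gcongr
    _ = (M + 3 * L) / (2 * μ ^ 2) * ‖g x‖ ^ 2 + L / μ ^ 2 * ‖g x‖ * ‖g z‖ := by
      field_simp
      ring
end
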